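/- Let G = (V, E, ℓ) be a vertex-labeled directed graph and let u, v ∈ V be distinct vertices. If u and v are out-trace equivalent (u ≡out v), then merging u into v introduces no new paths, i.e., every trace of a path of merge(G, u, v) is the trace of some path of G. -/

import Mathlib

/-- A path of `G = (V, E)`: a nonempty finite sequence of vertices with
consecutive vertices related by `E`. -/
def IsPath {V : Type*} (E : V → V → Prop) (p : List V) : Prop :=
  p ≠ [] ∧ p.Chain' E

/-- `u` is out-trace dominated by `v`: for every path starting at `u` there is
a path starting at `v` with the same trace. -/
def OutTraceDom {V L : Type*} (E : V → V → Prop) (ℓ : V → L) (u v : V) : Prop :=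
  ∀ p : List V, IsPath E p → p.head? = some u →
    ∃ q : List V, IsPath E q ∧ q.head? = some v ∧ q.map ℓ = p.map ℓ

/-- The edge relation of `merge(G, u, v)`. -/
def MergeEdge {V : Type*} (E : V → V → Prop) (u v : V) (a b : V) : Prop :=
  E a b ∨ (a = v ∧ E u b) ∨ (b = v ∧ E a u)

/-- A path of `merge(G, u, v)`. -/
def IsMergePath {V : Type*} (E : V → V → Prop) (u v : V) (p : List V) : Prop :=
  p ≠ [] ∧ (∀ x ∈ p, x ≠ u) ∧ p.Chain' (MergeEdge E u v)

/-- Merging `u` into `v` introduces no new paths. -/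
def NoNewPaths {V L : Type*} (E : V → V → Prop) (ℓ : V → L) (u v : V) : Prop :=
  ∀ p : List V, IsMergePath E u v p →
    ∃ q : List V, IsPath E q ∧ q.map ℓ = p.map ℓ

theorem IsPath.cons {V : Type*} {E : V → V → Prop} {a b : V} {q : List V}
    (hab : E a b) (hq : IsPath E q) (hb : q.head? = some b) : IsPath E (a :: q) := by
  refine ⟨List.cons_ne_nil a q, List.isChain_cons.2 ⟨fun y hy => ?_, hq.2⟩⟩
  rw [hb, Option.mem_some_iff] at hy
  exact hy ▸ hab

/-- If `u ≡out v`, a path of the merged relation starting at `a` has the trace of a path of `E`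
starting at the same vertex `a`. -/
theorem exists_isPath_of_isChain_mergeEdge {V L : Type*}
    {E : V → V → Prop} {ℓ : V → L} {u v : V}
    (h₁ : OutTraceDom E ℓ u v) (h₂ : OutTraceDom E ℓ v u) (p : List V) :
    ∀ a : V, (a :: p).IsChain (MergeEdge E u v) →
      ∃ q : List V, IsPath E q ∧ q.head? = some a ∧ q.map ℓ = (a :: p).map ℓ := by
  induction p with
  | nil =>
    exact fun a _ => ⟨[a], ⟨List.cons_ne_nil a [], List.isChain_singleton a⟩, rfl, rfl⟩
  | cons b t ih =>
    intro a hp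
    rw [List.isChain_cons_cons] at hp
    obtain ⟨hab, ht⟩ := hp
    obtain ⟨q, hq, hqb, hqt⟩ := ih b ht
    rcases hab with hab | ⟨rfl, hub⟩ | ⟨rfl, hau⟩
    · exact ⟨a :: q, hq.cons hab hqb, rfl, by simp [hqt]⟩
    · obtain ⟨r, hr, hra, hrt⟩ := h₁ (u :: q) (hq.cons hub hqb) rfl
      obtain ⟨s, -, hsu, hst⟩ :=
        h₁ [u] ⟨List.cons_ne_nil u [], List.isChain_singleton u⟩ rfl
      have hℓ : ℓ a = ℓ u := by
        have h := congrArg List.head? hst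
        simpa [List.head?_map, hsu] using h
      exact ⟨r, hr, hra, by simp [hrt, hqt, hℓ]⟩
    · obtain ⟨r, hr, hru, hrt⟩ := h₂ q hq hqb
      exact ⟨a :: r, hr.cons hau hru, rfl, by simp [hrt, hqt]⟩

/-- If `u ≡out v` (out-trace equivalent), merging `u` into `v` introduces no
new paths. -/
theorem outTraceEquiv_merge_no_new_paths {V L : Type*}
    (E : V → V → Prop) (ℓ : V → L) (u v : V) (hne : u ≠ v)
    (h₁ : OutTraceDom E ℓ u v) (h₂ : OutTraceDom E ℓ v u) :
    NoNewPaths E ℓ u v := by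
  rintro (_ | ⟨a, p⟩) ⟨hne_nil, -, hp⟩
  · exact absurd rfl hne_nil
  · obtain ⟨q, hq, -, hqt⟩ := exists_isPath_of_isChain_mergeEdge h₁ h₂ p a hp
    exact ⟨q, hq, hqt⟩
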